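/- There do not exist Borel maps φ : (2^ℕ)^ℕ → 2^ℕ and ψ : [ω]^ω → [ω]^ω such that for every sequence ⟨c_n⟩_{n∈ℕ} of elements of 2^ℕ and every B ∈ [ω]^ω: if φ(⟨c_n⟩) is almost constant on B, then for every n the function c_n is almost constant on ψ(B). (I.e., there is no Borel Tukey morphism from the unsplitting number 𝔯 to the σ-unsplitting number 𝔯_σ.) -/

import Mathlib

/-- The subset of ℕ coded by an element of Cantor space. -/
def bset (x : ℕ → Bool) : Set ℕ := {n | x n = true}

/-- `[ω]^ω`, regarded as a subspace of Cantor space via characteristic functions. -/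
abbrev InfC := {x : ℕ → Bool // (bset x).Infinite}

/-- `c` is almost constant on `B`: `c` is constant on `B` outside a finite set. -/
def AlmostConst (c : ℕ → Bool) (B : Set ℕ) : Prop :=
  ∃ b : Bool, {n ∈ B | c n ≠ b}.Finite

open PiNat

/-- Limit of a coherent sequence of finite conditions. -/
lemma lim_seq {α : Type*} (a : ℕ → ℕ → α) (n : ℕ → ℕ) (h : ∀ j, n j < n (j+1))
    (h2 : ∀ j, ∀ i < n j, a (j+1) i = a j i) : ∃ c : ℕ → α, ∀ j, ∀ i < n j, c i = a j i := by
  have hm : StrictMono n := strictMono_nat_of_lt_succ h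
  have key : ∀ j d i, i < n j → a (j + d) i = a j i := by
    intro j d
    induction d with
    | zero => intro i _; rfl
    | succ d ih =>
      intro i hi
      rw [← add_assoc, h2 (j+d) i (lt_of_lt_of_le hi (hm.monotone (Nat.le_add_right _ _)))]
      exact ih i hi
  refine ⟨fun i => a (i+1) i, fun j i hi => ?_⟩
  have hi' : i < n (i+1) := lt_of_lt_of_le (Nat.lt_succ_self i) (hm.id_le (i+1))
  rcases le_total j (i+1) with hj | hj
  · obtain ⟨d, hd⟩ := Nat.exists_eq_add_of_le hj
    show a (i+1) i = _
    rw [hd]; exact key j d i hi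
  · obtain ⟨d, hd⟩ := Nat.exists_eq_add_of_le hj
    show a (i+1) i = _
    rw [hd]; exact (key (i+1) d i hi').symm

/-- A function extending a (reversed) list. -/
def lfn : List ℕ → ℕ → ℕ
  | [] => fun _ => 0
  | k :: u => Function.update (lfn u) u.length k

lemma lfn_append (v u : List ℕ) : ∀ i < u.length, lfn (v ++ u) i = lfn u i := by
  induction v with
  | nil => intro i _; rfl
  | cons k v ih =>
    intro i hi
    have : i ≠ (v ++ u).length := by simp; omega
    simp only [List.cons_append, lfn]
    rw [Function.update_of_ne this]
    exact ih i hi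

lemma res_congr {b b' : ℕ → ℕ} {n : ℕ} (h : ∀ i < n, b i = b' i) : res b n = res b' n :=
  res_eq_res.2 (fun {_} hm => h _ hm)

lemma res_lfn (u : List ℕ) : res (lfn u) u.length = u := by
  induction u with
  | nil => rfl
  | cons k u ih =>
    rw [List.length_cons, res_succ]
    congr 1
    · simp [lfn]
    · conv_rhs => rw [← ih]
      exact res_congr (lfn_append [k] u)

lemma lim_list (u : ℕ → List ℕ) (h : ∀ j, ∃ v, v ≠ [] ∧ u (j+1) = v ++ u j) :
    ∃ b : ℕ → ℕ, ∀ j, res b (u j).length = u j := by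
  obtain ⟨b, hb⟩ := lim_seq (fun j => lfn (u j)) (fun j => (u j).length)
    (fun j => by
      obtain ⟨v, hv, e⟩ := h j
      have := List.length_pos_iff.2 hv
      simp [e]; omega)
    (fun j i hi => by
      obtain ⟨v, hv, e⟩ := h j
      simp only [e]
      exact lfn_append v _ i hi)
  refine ⟨b, fun j => ?_⟩
  rw [res_congr (hb j), res_lfn]

lemma res_append (b : ℕ → ℕ) {m n : ℕ} (h : m ≤ n) : ∃ v, res b n = v ++ res b m ∧
    ∀ k ∈ v, ∃ j, m ≤ j ∧ j < n ∧ k = b j := by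
  induction n, h using Nat.le_induction with
  | base => exact ⟨[], rfl, by simp⟩
  | succ n hn ih =>
    obtain ⟨v, e, hv⟩ := ih
    refine ⟨b n :: v, by rw [res_succ, e]; rfl, ?_⟩
    intro k hk
    rcases List.mem_cons.1 hk with rfl | hk
    · exact ⟨n, hn, Nat.lt_succ_self n, rfl⟩
    · obtain ⟨j, h1, h2, h3⟩ := hv k hk
      exact ⟨j, h1, by omega, h3⟩

lemma res_suffix {b : ℕ → ℕ} {v u : List ℕ} (h : res b (v ++ u).length = v ++ u) :
    res b u.length = u := by
  have h1 : u.length ≤ (v ++ u).length := by simp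
  obtain ⟨w, e, _⟩ := res_append b h1
  rw [h] at e
  have hl := (List.append_inj' e (by simp)).2
  exact hl.symm

/-- The nonprincipal ultrafilter. -/
noncomputable abbrev UU : Ultrafilter ℕ := Filter.hyperfilter ℕ

lemma UU_ge (n : ℕ) : ∀ᶠ k in (UU : Filter ℕ), n ≤ k := by
  have : (UU : Filter ℕ) ≤ Filter.atTop := by
    rw [← Nat.cofinite_eq_atTop]; exact Filter.hyperfilter_le_cofinite
  exact this (Filter.eventually_ge_atTop n)

/-- branches exist -/
lemma exists_branch (u : List ℕ) (F : List ℕ → Set ℕ)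
    (hF : ∀ v, ∀ᶠ k in (UU : Filter ℕ), k ∈ F v) :
    ∃ b : ℕ → ℕ, res b u.length = u ∧ ∀ n, u.length ≤ n → b n ∈ F (res b n) := by
  choose f hf using fun v => (hF v).exists
  obtain ⟨L, hL0, hL⟩ : ∃ L : ℕ → List ℕ, L 0 = u ∧ ∀ j, L (j+1) = f (L j) :: L j :=
    ⟨fun j => Nat.rec u (fun _ v => f v :: v) j, rfl, fun j => rfl⟩
  obtain ⟨b, hb⟩ := lim_list L (fun j => ⟨[f (L j)], by simp, by rw [hL]; rfl⟩)
  have hlen : ∀ j, (L j).length = u.length + j := by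
    intro j
    induction j with
    | zero => rw [hL0]; rfl
    | succ j ih => rw [hL, List.length_cons, ih]; omega
  refine ⟨b, by have := hb 0; rwa [hL0] at this, fun n hn => ?_⟩
  obtain ⟨j, rfl⟩ := Nat.exists_eq_add_of_le hn
  have h1 := hb (j+1)
  have h0 := hb j
  rw [hlen] at h1 h0
  rw [← add_assoc, res_succ, hL] at h1
  rw [h0]
  have := (List.cons.inj h1).1
  rw [this]
  exact hf _

/-- `Q u P`: there is an ultrafilter tree with stem `u` all of whose branches satisfy `P`. -/
def Q (u : List ℕ) (P : (ℕ → ℕ) → Prop) : Prop :=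
  ∃ F : List ℕ → Set ℕ, (∀ v, ∀ᶠ k in (UU : Filter ℕ), k ∈ F v) ∧
    ∀ b : ℕ → ℕ, res b u.length = u → (∀ n, u.length ≤ n → b n ∈ F (res b n)) → P b

lemma Q_mono {u : List ℕ} {P P' : (ℕ → ℕ) → Prop} (h : Q u P)
    (hP : ∀ b, res b u.length = u → P b → P' b) : Q u P' := by
  obtain ⟨F, h1, h2⟩ := h
  exact ⟨F, h1, fun b hb hb' => hP b hb (h2 b hb hb')⟩

lemma Q_of_forall {u : List ℕ} {P : (ℕ → ℕ) → Prop} (h : ∀ b, res b u.length = u → P b) :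
    Q u P := ⟨fun _ => Set.univ, by simp, fun b hb _ => h b hb⟩

lemma Q_fuse (u : List ℕ) (P : ℕ → List ℕ → (ℕ → ℕ) → Prop) (S : List ℕ → Set ℕ)
    (hS : ∀ v, ∀ᶠ k in (UU : Filter ℕ), k ∈ S v) (h : ∀ n v, Q v (P n v)) :
    Q u (fun b => (∀ m, u.length ≤ m → b m ∈ S (res b m)) ∧
      ∀ n m, u.length ≤ m → n ≤ m → P n (res b m) b) := by
  choose F hF hF' using h
  refine ⟨fun v => {k | k ∈ S v ∧ ∀ n ∈ Finset.range (v.length + 1), ∀ w ∈ v.tails.toFinset,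
    k ∈ F n w v}, ?_, ?_⟩
  · intro v
    refine (hS v).and ?_
    rw [Filter.eventually_all_finset]
    intro n _
    rw [Filter.eventually_all_finset]
    intro w _
    exact hF n w v
  · intro b hb hb'
    refine ⟨fun m hm => (hb' m hm).1, fun n m hm hn => ?_⟩
    apply hF'
    · rw [res_length]
    · intro m' hm'
      rw [res_length] at hm'
      refine (hb' m' (hm.trans hm')).2 n ?_ _ ?_
      · rw [res_length]; simp; omega
      · obtain ⟨v, e, _⟩ := res_append b hm'
        simp only [List.mem_toFinset, List.mem_tails]
        exact ⟨v, e.symm⟩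

lemma Q_cons {u : List ℕ} {P : (ℕ → ℕ) → Prop}
    (h : ∀ᶠ k in (UU : Filter ℕ), Q (k :: u) P) : Q u P := by
  classical
  have := Q_fuse u (fun _ v b => Q v P → P b) (fun v => {k | v = u → Q (k :: u) P})
    (fun v => by
      filter_upwards [h] with k hk _ using hk)
    (fun _ v => by
      by_cases hv : Q v P
      · exact Q_mono hv (fun b _ h _ => h)
      · exact Q_of_forall (fun b _ h => absurd h hv))
  refine Q_mono this ?_
  rintro b hb ⟨h1, h2⟩
  have h3 := h1 u.length le_rfl hb
  refine h2 0 (u.length + 1) (by omega) (by omega) ?_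
  rw [res_succ, hb]
  exact h3

lemma Q_union (X : ℕ → Set (ℕ → ℕ))
    (h : ∀ n u, Q u (fun b => b ∈ X n) ∨ Q u (fun b => b ∉ X n)) (u : List ℕ) :
    Q u (fun b => b ∈ ⋃ n, X n) ∨ Q u (fun b => b ∉ ⋃ n, X n) := by
  classical
  by_cases hu : Q u (fun b => b ∈ ⋃ n, X n)
  · exact Or.inl hu
  right
  set Bad : List ℕ → Prop := fun v => ¬ Q v (fun b => b ∈ ⋃ n, X n) with hBad
  have := Q_fuse u (fun n v b => Bad v → b ∉ X n) (fun v => {k | Bad v → Bad (k :: v)})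
    (fun v => by
      by_cases hv : Bad v
      · by_contra hc
        rw [← Ultrafilter.eventually_not] at hc
        apply hv
        apply Q_cons
        filter_upwards [hc] with k hk
        simp only [Classical.not_imp, hBad, not_not] at hk
        exact hk.2
      · exact Filter.Eventually.of_forall (fun k h => absurd h hv))
    (fun n v => by
      rcases h n v with h | h
      · apply Q_of_forall
        intro b _ hv
        exact absurd (Q_mono h (fun b _ hb => Set.mem_iUnion.2 ⟨n, hb⟩)) hv
      · exact Q_mono h (fun b _ hb _ => hb))
  refine Q_mono this ?_
  rintro b hb ⟨h1, h2⟩ hmem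
  have hbad : ∀ m, u.length ≤ m → Bad (res b m) := by
    intro m hm
    induction m, hm using Nat.le_induction with
    | base => rw [hb]; exact hu
    | succ m hm ih => rw [res_succ]; exact h1 m hm ih
  obtain ⟨n, hn⟩ := Set.mem_iUnion.1 hmem
  exact h2 n (max u.length n) (le_max_left _ _) (le_max_right _ _)
    (hbad _ (le_max_left _ _)) hn

/-- The sigma-algebra of ultra-Ramsey sets. -/
@[reducible] def ramseySpace : MeasurableSpace (ℕ → ℕ) where
  MeasurableSet' X := ∀ u, Q u (fun b => b ∈ X) ∨ Q u (fun b => b ∉ X)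
  measurableSet_empty u := Or.inr (Q_of_forall (fun b _ h => h))
  measurableSet_compl X h u := by
    rcases h u with h | h
    · right; exact Q_mono h (fun b _ hb hc => hc hb)
    · left; exact Q_mono h (fun b _ hb => hb)
  measurableSet_iUnion X h u := Q_union X h u

lemma ramsey_borel (X : Set (ℕ → ℕ)) (hX : MeasurableSet X) (u : List ℕ) :
    Q u (fun b => b ∈ X) ∨ Q u (fun b => b ∉ X) := by
  have hle : (MeasurableSpace.pi : MeasurableSpace (ℕ → ℕ)) ≤ ramseySpace := by
    refine iSup_le fun n => ?_
    rintro _ ⟨S, _, rfl⟩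
    have h1 : ∀ u : List ℕ, n < u.length →
        Q u (fun b => b n ∈ S) ∨ Q u (fun b => b n ∉ S) := by
      intro u hu
      have hb : ∀ b, res b u.length = u → b n = lfn u n := by
        intro b hb
        have : res b u.length = res (lfn u) u.length := by rw [hb, res_lfn]
        exact res_eq_res.1 this hu
      by_cases hs : lfn u n ∈ S
      · left; exact Q_of_forall (fun b h => by rw [hb b h]; exact hs)
      · right; exact Q_of_forall (fun b h => by rw [hb b h]; exact hs)
    have h2 : ∀ d, ∀ u : List ℕ, n < u.length + d →
        Q u (fun b => b n ∈ S) ∨ Q u (fun b => b n ∉ S) := by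
      intro d
      induction d with
      | zero => exact h1
      | succ d ih =>
        intro u hu
        have h3 : ∀ k, Q (k :: u) (fun b => b n ∈ S) ∨ Q (k :: u) (fun b => b n ∉ S) :=
          fun k => ih _ (by rw [List.length_cons]; omega)
        by_cases hc : ∀ᶠ k in (UU : Filter ℕ), Q (k :: u) (fun b => b n ∈ S)
        · exact Or.inl (Q_cons hc)
        · rw [← Ultrafilter.eventually_not] at hc
          right
          apply Q_cons
          filter_upwards [hc] with k hk
          exact (h3 k).resolve_left hk
    intro u
    exact h2 (n+1) u (by omega)
  exact hle X hX u

/-- The abstract situation. -/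
structure Setup where
  Θ : (ℕ → Bool × Bool) → ℕ → Bool
  Gn : ℕ → Set (ℕ → Bool × Bool)
  Y : (ℕ → ℕ) → Set ℕ
  hG : ∀ (j : ℕ) (a : ℕ → Bool × Bool) (n : ℕ), ∃ (a' : ℕ → Bool × Bool) (n' : ℕ), n ≤ n' ∧
    (∀ i < n, a' i = a i) ∧ ∀ c : ℕ → Bool × Bool, (∀ i < n', c i = a' i) → c ∈ Gn j
  hcont : ∀ c : ℕ → Bool × Bool, (∀ j, c ∈ Gn j) → ∀ k, ∃ m : ℕ, ∀ d : ℕ → Bool × Bool,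
    (∀ j, d ∈ Gn j) → (∀ i < m, d i = c i) → Θ d k = Θ c k
  hYinf : ∀ b, StrictMono b → (Y b).Infinite
  hYram : ∀ l u, Q u (fun b => l ∈ Y b) ∨ Q u (fun b => l ∉ Y b)
  hH : ∀ b, StrictMono b → ∀ c i N, (∀ n, N ≤ n → Θ c (b n) = i) →
    ∃ (t : Bool × Bool) (N' : ℕ), ∀ l ∈ Y b, N' ≤ l → c l = t

namespace Setup

variable (S : Setup)

/-- The condition `a` restricted to `n` forces that the value at `k` is `i`. -/
def Fo (a : ℕ → Bool × Bool) (n k : ℕ) (i : Bool) : Prop :=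
  ∀ c : ℕ → Bool × Bool, (∀ j, c ∈ S.Gn j) → (∀ j < n, c j = a j) → S.Θ c k = i

lemma Fo_mono {a a' : ℕ → Bool × Bool} {n n' k : ℕ} {i : Bool} (h : S.Fo a n k i)
    (hn : n ≤ n') (ha : ∀ j < n, a' j = a j) : S.Fo a' n' k i :=
  fun c hc h' => h c hc (fun j hj => by rw [h' j (by omega), ha j hj])

lemma Fo_of_mem {c : ℕ → Bool × Bool} (hc : ∀ j, c ∈ S.Gn j) (k n : ℕ) :
    ∃ m, n ≤ m ∧ S.Fo c m k (S.Θ c k) := by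
  obtain ⟨m, hm⟩ := S.hcont c hc k
  exact ⟨max n m, le_max_left _ _, fun d hd h =>
    hm d hd (fun i hi => h i (lt_of_lt_of_le hi (le_max_right _ _)))⟩

/-- A generic function that is not almost constant on `Y`. -/
lemma exists_generic (a : ℕ → Bool × Bool) (n : ℕ) (Y : Set ℕ) (hY : Y.Infinite) :
    ∃ c : ℕ → Bool × Bool, (∀ j, c ∈ S.Gn j) ∧ (∀ j < n, c j = a j) ∧
      ∀ N : ℕ, ∃ l ∈ Y, ∃ l' ∈ Y, N ≤ l ∧ N ≤ l' ∧ c l ≠ c l' := by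
  have step : ∀ (j : ℕ) (s : (ℕ → Bool × Bool) × ℕ), ∃ s' : (ℕ → Bool × Bool) × ℕ,
      s.2 < s'.2 ∧ (∀ i < s.2, s'.1 i = s.1 i) ∧
      (∀ c : ℕ → Bool × Bool, (∀ i < s'.2, c i = s'.1 i) → c ∈ S.Gn j) ∧
      ∃ l ∈ Y, ∃ l' ∈ Y, s.2 ≤ l ∧ s.2 ≤ l' ∧ l < s'.2 ∧ l' < s'.2 ∧ s'.1 l ≠ s'.1 l' := by
    rintro j ⟨a, n⟩
    obtain ⟨a', n', h1, h2, h3⟩ := S.hG j a n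
    obtain ⟨l, hl, hl'⟩ := hY.exists_gt n'
    obtain ⟨m, hm, hm'⟩ := hY.exists_gt l
    refine ⟨(Function.update (Function.update a' l (true, true)) m (false, false), m+1),
      by simp; omega, ?_, ?_, l, hl, m, hm, by simp; omega, by simp; omega, by simp; omega,
      by simp, ?_⟩
    · intro i hi
      simp only at hi
      simp only
      rw [Function.update_of_ne (by omega), Function.update_of_ne (by omega)]
      exact h2 i hi
    · intro c hc
      apply h3
      intro i hi
      rw [hc i (by simp; omega)]
      simp only
      rw [Function.update_of_ne (by omega), Function.update_of_ne (by omega)]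
    · simp only
      rw [Function.update_of_ne (by omega)]
      simp
  choose f hf1 hf2 hf3 hf4 using step
  obtain ⟨s, hs0, hs⟩ : ∃ s : ℕ → (ℕ → Bool × Bool) × ℕ, s 0 = (a, n) ∧
    ∀ j, s (j+1) = f j (s j) := ⟨fun j => Nat.rec (a, n) (fun j v => f j v) j, rfl, fun j => rfl⟩
  have hlt : ∀ j, (s j).2 < (s (j+1)).2 := fun j => by rw [hs]; exact hf1 _ _
  obtain ⟨c, hc⟩ := lim_seq (fun j => (s j).1) (fun j => (s j).2) hlt
    (fun j => by rw [hs]; exact hf2 _ _)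
  have hm : StrictMono (fun j => (s j).2) := strictMono_nat_of_lt_succ hlt
  refine ⟨c, fun j => ?_, ?_, ?_⟩
  · apply hf3 j (s j)
    rw [← hs]; exact hc (j+1)
  · have := hc 0
    simpa [hs0] using this
  · intro N
    obtain ⟨l, hl, l', hl', h1, h2, h3, h4, h5⟩ := hf4 N (s N)
    rw [← hs] at h3 h4 h5
    have hN : N ≤ (s N).2 := hm.id_le N
    refine ⟨l, hl, l', hl', hN.trans h1, hN.trans h2, ?_⟩
    rw [hc (N+1) l h3, hc (N+1) l' h4]
    exact h5

/-- Any condition can be extended to force the value `i` at ultrafilter many points. -/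
lemma factA (a : ℕ → Bool × Bool) (n : ℕ) (i : Bool) :
    ∀ᶠ k in (UU : Filter ℕ), ∃ (a' : ℕ → Bool × Bool) (n' : ℕ), n ≤ n' ∧
      (∀ j < n, a' j = a j) ∧ S.Fo a' n' k i := by
  by_contra hc
  rw [← Ultrafilter.eventually_not] at hc
  have h1 : ∀ᶠ k in (UU : Filter ℕ), S.Fo a n k (!i) := by
    filter_upwards [hc] with k hk c hc h
    by_contra hne
    apply hk
    obtain ⟨m, hm, hm'⟩ := S.Fo_of_mem hc k n
    refine ⟨c, m, hm, h, ?_⟩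
    have : S.Θ c k = i := by
      cases i <;> simp_all
    rwa [this] at hm'
  obtain ⟨b, -, hb⟩ := exists_branch [] (fun v => {k | S.Fo a n k (!i) ∧ v.headD 0 + 1 ≤ k})
    (fun v => h1.and (UU_ge _))
  have hmono : StrictMono b := by
    apply strictMono_nat_of_lt_succ
    intro m
    have := (hb (m+1) (by simp)).2
    rw [res_succ] at this
    simpa using this
  obtain ⟨c, hc1, hc2, hc3⟩ := S.exists_generic a n (S.Y b) (S.hYinf b hmono)
  obtain ⟨t, N, hN⟩ := S.hH b hmono c (!i) 0 (fun m _ => (hb m (by simp)).1 c hc1 hc2)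
  obtain ⟨l, hl, l', hl', h1, h2, h3⟩ := hc3 N
  exact h3 ((hN l hl h1).trans (hN l' hl' h2).symm)

/-- A bound for the length of conditions. -/
lemma exists_g : ∃ g : ℕ → ℕ, (∀ k, k ≤ g k) ∧ ∀ k n (a : ℕ → Bool × Bool) i, n ≤ k →
    (∃ (a' : ℕ → Bool × Bool) (n' : ℕ), n ≤ n' ∧ (∀ j < n, a' j = a j) ∧ S.Fo a' n' k i) →
    ∃ (a' : ℕ → Bool × Bool) (n' : ℕ), n ≤ n' ∧ n' ≤ g k ∧ (∀ j < n, a' j = a j) ∧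
      S.Fo a' n' k i := by
  have h : ∀ k, ∃ M, k ≤ M ∧ ∀ n (a : ℕ → Bool × Bool) i, n ≤ k →
    (∃ (a' : ℕ → Bool × Bool) (n' : ℕ), n ≤ n' ∧ (∀ j < n, a' j = a j) ∧ S.Fo a' n' k i) →
    ∃ (a' : ℕ → Bool × Bool) (n' : ℕ), n ≤ n' ∧ n' ≤ M ∧ (∀ j < n, a' j = a j) ∧
      S.Fo a' n' k i := by
    intro k
    have h1 : ∀ x : (Σ n : Fin (k+1), (Fin n → Bool × Bool)) × Bool, ∃ M : ℕ,
      (∃ (a' : ℕ → Bool × Bool) (n' : ℕ), x.1.1 ≤ n' ∧ (∀ j : Fin x.1.1, a' j = x.1.2 j) ∧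
        S.Fo a' n' k x.2) →
      ∃ (a' : ℕ → Bool × Bool) (n' : ℕ), x.1.1 ≤ n' ∧ n' ≤ M ∧
        (∀ j : Fin x.1.1, a' j = x.1.2 j) ∧ S.Fo a' n' k x.2 := by
      intro x
      by_cases hx : ∃ (a' : ℕ → Bool × Bool) (n' : ℕ), x.1.1 ≤ n' ∧
        (∀ j : Fin x.1.1, a' j = x.1.2 j) ∧ S.Fo a' n' k x.2
      · obtain ⟨a', n', h1, h2, h3⟩ := hx
        exact ⟨n', fun _ => ⟨a', n', h1, le_rfl, h2, h3⟩⟩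
      · exact ⟨0, fun h => absurd h hx⟩
    choose M hM using h1
    refine ⟨max k (Finset.univ.sup M), le_max_left _ _, ?_⟩
    rintro n a i hn ⟨a', n', h1, h2, h3⟩
    obtain ⟨a'', n'', h1, h4, h2, h3⟩ := hM (⟨⟨n, by omega⟩, fun j => a j⟩, i)
      ⟨a', n', h1, fun j => h2 j j.2, h3⟩
    exact ⟨a'', n'', h1, h4.trans ((Finset.le_sup (Finset.mem_univ _)).trans (le_max_right _ _)),
      fun j hj => h2 ⟨j, hj⟩, h3⟩
  choose g hg1 hg2 using h
  exact ⟨g, hg1, hg2⟩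

/-- The tree on which everything is continuous. -/
lemma exists_tree (g : ℕ → ℕ) : ∃ (F : List ℕ → Set ℕ) (Ψ : List ℕ → Set ℕ),
    (∀ v, ∀ᶠ k in (UU : Filter ℕ), k ∈ F v) ∧
    ∀ b : ℕ → ℕ, (∀ n, b n ∈ F (res b n)) → StrictMono b ∧
      (∀ n, ∀ l ∈ Ψ (res b n), l ∈ S.Y b) ∧
      ∀ n, ∀ l ∈ S.Y b, l < g (b n) → l ∈ Ψ (res b (n+1)) := by
  let gg : List ℕ → ℕ := fun v => match v with
    | [] => 0
    | k :: _ => g k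
  let Ψ : List ℕ → Set ℕ := fun v => {l | l < gg v ∧ Q v (fun b => l ∈ S.Y b)}
  have hP : ∀ (m : ℕ) (v : List ℕ), Q v (fun b => ∀ l < gg v, (l ∈ S.Y b ↔ l ∈ Ψ v)) := by
    intro _ v
    have : ∀ M, Q v (fun b => ∀ l < M, l < gg v → (l ∈ S.Y b ↔ l ∈ Ψ v)) := by
      intro M
      induction M with
      | zero => exact Q_of_forall (fun b _ l hl => absurd hl (by omega))
      | succ M ih =>
        have h1 : Q v (fun b => M < gg v → (M ∈ S.Y b ↔ M ∈ Ψ v)) := by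
          by_cases hq : Q v (fun b => M ∈ S.Y b)
          · exact Q_mono hq (fun b _ hb hM => ⟨fun _ => ⟨hM, hq⟩, fun _ => hb⟩)
          · exact Q_mono ((S.hYram M v).resolve_left hq)
              (fun b _ hb hM => ⟨fun h => absurd h hb, fun h => absurd h.2 hq⟩)
        obtain ⟨F1, h1, h1'⟩ := h1
        obtain ⟨F2, h2, h2'⟩ := ih
        refine ⟨fun w => F1 w ∩ F2 w, fun w => (h1 w).and (h2 w), ?_⟩
        intro b hb hb' l hl
        rcases Nat.lt_succ_iff_lt_or_eq.1 hl with hl | rfl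
        · exact h2' b hb (fun n hn => (hb' n hn).2) l hl
        · exact h1' b hb (fun n hn => (hb' n hn).1)
    exact Q_mono (this (gg v)) (fun b _ h l hl => h l hl hl)
  obtain ⟨F, hF, hF'⟩ := Q_fuse [] (fun _ v b => ∀ l < gg v, (l ∈ S.Y b ↔ l ∈ Ψ v))
    (fun v => {k | v.headD 0 + 1 ≤ k}) (fun v => UU_ge _) hP
  refine ⟨F, Ψ, hF, fun b hb => ?_⟩
  obtain ⟨h1, h2⟩ := hF' b rfl (fun n _ => hb n)
  refine ⟨?_, ?_, ?_⟩
  · apply strictMono_nat_of_lt_succ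
    intro m
    have := h1 (m+1) (by simp)
    rw [res_succ] at this
    simpa using this
  · intro n l hl
    exact (h2 0 n (by simp) (by simp) l hl.1).2 hl
  · intro n l hl hlt
    exact (h2 0 (n+1) (by simp) (by simp) l hlt).1 hl

end Setup

/-- The nodes of the tree given by `F`. -/
def TN (F : List ℕ → Set ℕ) : List ℕ → Prop
  | [] => True
  | k :: u => k ∈ F u ∧ TN F u

lemma TN_append {F : List ℕ → Set ℕ} {v u : List ℕ} (h : TN F (v ++ u)) : TN F u := by
  induction v with
  | nil => exact h
  | cons k v ih => exact ih h.2

lemma TN_res {F : List ℕ → Set ℕ} {b : ℕ → ℕ} {m : ℕ} (h : TN F (res b m)) :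
    ∀ n < m, b n ∈ F (res b n) := by
  induction m with
  | zero => intro n hn; omega
  | succ m ih =>
    rw [res_succ] at h
    intro n hn
    rcases Nat.lt_succ_iff_lt_or_eq.1 hn with hn | rfl
    · exact ih h.2 n hn
    · exact h.1

lemma TN_of_res {F : List ℕ → Set ℕ} {b : ℕ → ℕ} (h : ∀ n, b n ∈ F (res b n)) (m : ℕ) :
    TN F (res b m) := by
  induction m with
  | zero => trivial
  | succ m ih => rw [res_succ]; exact ⟨h m, ih⟩

/-- Positions. -/
structure St where
  a : ℕ → Bool × Bool
  n : ℕ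
  u : List ℕ

namespace Setup

variable (S : Setup) (F : List ℕ → Set ℕ)

/-- The second position extends the first, and all new points have value `i`. -/
def Ext (i : Bool) (s s' : St) : Prop :=
  s.n ≤ s'.n ∧ (∀ j < s.n, s'.a j = s.a j) ∧ TN F s'.u ∧
    ∃ v, s'.u = v ++ s.u ∧ ∀ k ∈ v, S.Fo s'.a s'.n k i

lemma Ext_refl (i : Bool) (s : St) (h : TN F s.u) : S.Ext F i s s :=
  ⟨le_rfl, fun _ _ => rfl, h, [], rfl, by simp⟩

lemma Ext_trans {i : Bool} {s s' s'' : St} (h : S.Ext F i s s') (h' : S.Ext F i s' s'') :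
    S.Ext F i s s'' := by
  obtain ⟨h1, h2, h3, v, h4, h5⟩ := h
  obtain ⟨h1', h2', h3', v', h4', h5'⟩ := h'
  refine ⟨h1.trans h1', fun j hj => by rw [h2' j (by omega), h2 j hj], h3', v' ++ v, ?_, ?_⟩
  · rw [h4', h4, List.append_assoc]
  · intro k hk
    rcases List.mem_append.1 hk with hk | hk
    · exact h5' k hk
    · have h7 := S.Fo_mono (h5 k hk) h1' h2'
      exact h7

/-- `(i,t)`-good positions. -/
def Good (Ψ : List ℕ → Set ℕ) (i : Bool) (t : Bool × Bool) (s : St) : Prop :=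
  ∀ s', S.Ext F i s s' → ∀ l ∈ Ψ s'.u, s.n ≤ l → l < s'.n → s'.a l = t

lemma Good_ext {Ψ : List ℕ → Set ℕ} {i : Bool} {t : Bool × Bool} {s s' : St}
    (h : S.Good F Ψ i t s) (h' : S.Ext F i s s') : S.Good F Ψ i t s' :=
  fun s'' hs l hl h1 h2 => h s'' (S.Ext_trans F h' hs) l hl (h'.1.trans h1) h2

lemma Ext_cons (hF : ∀ v, ∀ᶠ k in (UU : Filter ℕ), k ∈ F v) (i : Bool) (s : St)
    (P : ℕ → Prop) (hP : ∀ᶠ k in (UU : Filter ℕ), P k) :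
    ∃ k, P k ∧ k ∈ F s.u ∧ ∃ (a' : ℕ → Bool × Bool) (n' : ℕ), s.n ≤ n' ∧
      (∀ j < s.n, a' j = s.a j) ∧ S.Fo a' n' k i := by
  obtain ⟨k, h1, h2, h3⟩ := (hP.and ((hF s.u).and (S.factA s.a s.n i))).exists
  exact ⟨k, h1, h2, h3⟩

lemma claim1 (Ψ : List ℕ → Set ℕ) (hF : ∀ v, ∀ᶠ k in (UU : Filter ℕ), k ∈ F v)
    (hb : ∀ b : ℕ → ℕ, (∀ n, b n ∈ F (res b n)) → StrictMono b ∧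
      (∀ n, ∀ l ∈ Ψ (res b n), l ∈ S.Y b)) (i : Bool) (s₀ : St) (hs₀ : TN F s₀.u) :
    ∃ s t, S.Ext F i s₀ s ∧ S.Good F Ψ i t s := by
  by_contra hcon
  push Not at hcon
  have hcon' : ∀ s t, S.Ext F i s₀ s → ∃ s', S.Ext F i s s' ∧ ∃ l ∈ Ψ s'.u,
      s.n ≤ l ∧ l < s'.n ∧ s'.a l ≠ t := by
    intro s t hs
    have := hcon s t hs
    simp only [Good] at this
    push Not at this
    obtain ⟨s', h1, l, h2, h3, h4, h5⟩ := this
    exact ⟨s', h1, l, h2, h3, h4, h5⟩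
  have step : ∀ (j : ℕ) (s : {s // S.Ext F i s₀ s}), ∃ s' : {s // S.Ext F i s₀ s},
      S.Ext F i s.1 s'.1 ∧ s.1.n < s'.1.n ∧ (∃ v, v ≠ [] ∧ s'.1.u = v ++ s.1.u) ∧
      (∀ c : ℕ → Bool × Bool, (∀ i < s'.1.n, c i = s'.1.a i) → c ∈ S.Gn j) ∧
      ∃ l l', s.1.n ≤ l ∧ s.1.n ≤ l' ∧ l < s'.1.n ∧ l' < s'.1.n ∧ s'.1.a l ≠ s'.1.a l' ∧
        ∀ b : ℕ → ℕ, (∀ n, b n ∈ F (res b n)) → res b s'.1.u.length = s'.1.u →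
          l ∈ S.Y b ∧ l' ∈ S.Y b := by
    rintro j ⟨s, hs⟩
    obtain ⟨s1, e1, l, hl, hl1, hl2, -⟩ := hcon' s (true, true) hs
    have hs1 := S.Ext_trans F hs e1
    obtain ⟨s2, e2, l', hl', hl1', hl2', hne⟩ := hcon' s1 (s1.a l) hs1
    have hs2 := S.Ext_trans F hs1 e2
    have hl1'' := e1.1
    have hl2'' := e2.1
    obtain ⟨k, -, hk, a3, n3, h1, h2, h3⟩ := S.Ext_cons F hF i s2 (fun _ => True)
      (Filter.Eventually.of_forall (fun _ => trivial))
    obtain ⟨a4, n4, h4, h5, h6⟩ := S.hG j a3 n3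
    let s4 : St := ⟨a4, n4, k :: s2.u⟩
    have e4 : S.Ext F i s2 s4 := by
      refine ⟨h1.trans h4, fun j hj => by
        show a4 j = _
        rw [h5 j (by omega), h2 j hj], ⟨hk, e2.2.2.1⟩, [k], rfl, ?_⟩
      intro k' hk'
      rw [List.mem_singleton.1 hk']
      exact S.Fo_mono h3 h4 h5
    have h42 : ∀ m < s2.n, a4 m = s2.a m := e4.2.1
    obtain ⟨v1, hv1, -⟩ := e1.2.2.2
    obtain ⟨v2, hv2, -⟩ := e2.2.2.2
    refine ⟨⟨s4, S.Ext_trans F hs2 e4⟩, S.Ext_trans F e1 (S.Ext_trans F e2 e4), ?_, ?_, h6,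
      l, l', hl1, by show s.n ≤ l'; omega, ?_, ?_, ?_, ?_⟩
    · show s.n < n4
      omega
    · refine ⟨k :: (v2 ++ v1), by simp, ?_⟩
      show k :: s2.u = _
      rw [hv2, hv1]; simp
    · show l < n4
      omega
    · show l' < n4
      omega
    · show a4 l ≠ a4 l'
      rw [h42 l (by omega), h42 l' hl2', e2.2.1 l hl2]
      exact hne.symm
    · intro b hbr hres
      have r2 : res b s2.u.length = s2.u := res_suffix (v := [k]) hres
      have r1 : res b s1.u.length = s1.u := by
        rw [hv2] at r2
        exact res_suffix r2
      refine ⟨(hb b hbr).2 _ l (by rw [r1]; exact hl), (hb b hbr).2 _ l' (by rw [r2]; exact hl')⟩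
  choose f hf0 hf1 hf2 hf3 hf4 using step
  obtain ⟨s, hs0, hs⟩ : ∃ s : ℕ → {s // S.Ext F i s₀ s}, s 0 = ⟨s₀, S.Ext_refl F i s₀ hs₀⟩ ∧
    ∀ j, s (j+1) = f j (s j) :=
    ⟨fun j => Nat.rec ⟨s₀, S.Ext_refl F i s₀ hs₀⟩ (fun j v => f j v) j, rfl, fun j => rfl⟩
  have hlt : ∀ j, (s j).1.n < (s (j+1)).1.n := fun j => by rw [hs]; exact hf1 _ _
  obtain ⟨c, hc⟩ := lim_seq (fun j => (s j).1.a) (fun j => (s j).1.n) hlt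
    (fun j => by rw [hs]; exact (hf0 _ _).2.1)
  obtain ⟨b, hbs⟩ := lim_list (fun j => (s j).1.u) (fun j => by rw [hs]; exact hf2 _ _)
  have hm : StrictMono (fun j => (s j).1.n) := strictMono_nat_of_lt_succ hlt
  have hlen : StrictMono (fun j => (s j).1.u.length) := by
    apply strictMono_nat_of_lt_succ
    intro j
    obtain ⟨v, hv, e⟩ := hf2 j (s j)
    rw [hs, e, List.length_append]
    have := List.length_pos_iff.2 hv
    omega
  have hcG : ∀ j, c ∈ S.Gn j := by
    intro j
    apply hf3 j (s j)
    rw [← hs]; exact hc (j+1)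
  have hbr : ∀ n, b n ∈ F (res b n) := by
    intro n
    have h1 : TN F (res b (s (n+1)).1.u.length) := by
      rw [hbs (n+1)]; exact (s (n+1)).2.2.2.1
    exact TN_res h1 n (lt_of_lt_of_le (Nat.lt_succ_self n) (hlen.id_le (n+1)))
  have hmono := (hb b hbr).1
  have hcon : ∀ n, s₀.u.length ≤ n → S.Θ c (b n) = i := by
    intro n hn
    obtain ⟨v, hv, hfo⟩ := (s (n+1)).2.2.2.2
    have hn' : n < (s (n+1)).1.u.length :=
      lt_of_lt_of_le (Nat.lt_succ_self n) (hlen.id_le (n+1))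
    have h1 := hbs (n+1)
    have hr0 : res b s₀.u.length = s₀.u := by
      have h2 := hbs 0
      rw [hs0] at h2
      exact h2
    have hmem : b n ∈ v := by
      obtain ⟨w, hw, -⟩ := res_append b (m := n+1) (n := (s (n+1)).1.u.length) hn'
      obtain ⟨w', hw', -⟩ := res_append b hn
      rw [h1, hv, res_succ, hw', hr0] at hw
      have : v = w ++ b n :: w' := by
        apply List.append_cancel_right (bs := s₀.u)
        rw [hw]; simp
      rw [this]; simp
    exact hfo _ hmem c hcG (hc (n+1))
  obtain ⟨t, N, hN⟩ := S.hH b hmono c i _ hcon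
  obtain ⟨l, l', h1, h2, h3, h4, h5, h6⟩ := hf4 N (s N)
  rw [← hs] at h3 h4 h5 h6
  obtain ⟨h7, h8⟩ := h6 b hbr (hbs (N+1))
  have hNle : N ≤ (s N).1.n := hm.id_le N
  apply h5
  rw [← hc (N+1) l h3, ← hc (N+1) l' h4, hN l h7 (hNle.trans h1), hN l' h8 (hNle.trans h2)]

lemma claim2 (g : ℕ → ℕ) (hg0 : ∀ k, k ≤ g k)
    (hg : ∀ k n (a : ℕ → Bool × Bool) i, n ≤ k →
    (∃ (a' : ℕ → Bool × Bool) (n' : ℕ), n ≤ n' ∧ (∀ j < n, a' j = a j) ∧ S.Fo a' n' k i) →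
    ∃ (a' : ℕ → Bool × Bool) (n' : ℕ), n ≤ n' ∧ n' ≤ g k ∧ (∀ j < n, a' j = a j) ∧
      S.Fo a' n' k i)
    (Ψ : List ℕ → Set ℕ) (hF : ∀ v, ∀ᶠ k in (UU : Filter ℕ), k ∈ F v)
    (hb : ∀ b : ℕ → ℕ, (∀ n, b n ∈ F (res b n)) → StrictMono b ∧
      (∀ n, ∀ l ∈ Ψ (res b n), l ∈ S.Y b) ∧
      ∀ n, ∀ l ∈ S.Y b, l < g (b n) → l ∈ Ψ (res b (n+1))) (i : Bool) (s₀ : St)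
    (hs₀ : TN F s₀.u) :
    ∃ s, S.Ext F i s₀ s ∧ ∀ᶠ k in (UU : Filter ℕ), ∃ l ∈ Ψ (k :: s.u), s.n ≤ l := by
  by_contra hcon
  push Not at hcon
  have step : ∀ (s : {s // S.Ext F i s₀ s}), ∃ s' : {s // S.Ext F i s₀ s}, ∃ k,
      s'.1.u = k :: s.1.u ∧ s'.1.n ≤ g k ∧ ∀ l ∈ Ψ s'.1.u, l < s.1.n := by
    rintro ⟨s, hs⟩
    have h1 := hcon s hs
    obtain ⟨k, ⟨hk1, hk2⟩, hk, hex⟩ := S.Ext_cons F hF i s _ (h1.and (UU_ge s.n))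
    obtain ⟨a', n', h2, h3, h4, h5⟩ := hg k s.n s.a i hk2 hex
    refine ⟨⟨⟨a', n', k :: s.u⟩, S.Ext_trans F hs ⟨h2, h4, ⟨hk, hs.2.2.1⟩, [k], rfl, ?_⟩⟩,
      k, rfl, h3, ?_⟩
    · intro k' hk'
      rw [List.mem_singleton.1 hk']
      exact h5
    · exact hk1
  choose f kk hf1 hf2 hf3 using step
  obtain ⟨s, hs0, hs⟩ : ∃ s : ℕ → {s // S.Ext F i s₀ s}, s 0 = ⟨s₀, S.Ext_refl F i s₀ hs₀⟩ ∧
    ∀ j, s (j+1) = f (s j) :=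
    ⟨fun j => Nat.rec ⟨s₀, S.Ext_refl F i s₀ hs₀⟩ (fun _ v => f v) j, rfl, fun j => rfl⟩
  have hu : ∀ j, (s (j+1)).1.u = kk (s j) :: (s j).1.u := fun j => by rw [hs]; exact hf1 _
  have hlen : ∀ j, (s j).1.u.length = s₀.u.length + j := by
    intro j
    induction j with
    | zero => rw [hs0]; rfl
    | succ j ih => rw [hu, List.length_cons, ih]; omega
  obtain ⟨b, hbs⟩ := lim_list (fun j => (s j).1.u)
    (fun j => ⟨[kk (s j)], by simp, by rw [hu]; rfl⟩)
  have hbs' : ∀ j, res b (s₀.u.length + j) = (s j).1.u := by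
    intro j
    rw [← hlen]; exact hbs j
  have hbk : ∀ j, b (s₀.u.length + j) = kk (s j) := by
    intro j
    have := hbs' (j+1)
    rw [← add_assoc, res_succ, hu] at this
    exact (List.cons.inj this).1
  have hbr : ∀ n, b n ∈ F (res b n) := by
    intro n
    have h1 : TN F (res b (s₀.u.length + (n+1))) := by
      rw [hbs' (n+1)]; exact (s (n+1)).2.2.2.1
    exact TN_res h1 n (by omega)
  obtain ⟨hmono, hb1, hb2⟩ := hb b hbr
  have hcl : ∀ j, ∀ l ∈ Ψ (s (j+1)).1.u, l < s₀.n := by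
    intro j
    induction j with
    | zero =>
      intro l hl
      rw [hs] at hl
      have := hf3 _ l hl
      rwa [hs0] at this
    | succ j ih =>
      intro l hl
      have hY : l ∈ S.Y b := by
        apply hb1 (s₀.u.length + (j+1+1))
        rw [hbs']; exact hl
      rw [hs] at hl
      have h1 := hf3 _ l hl
      rw [hs j] at h1
      have h2 := lt_of_lt_of_le h1 (hf2 (s j))
      apply ih
      rw [← hbs', ← add_assoc]
      apply hb2 _ l hY
      rw [hbk]; exact h2
  apply S.hYinf b hmono
  apply (Set.finite_Iio s₀.n).subset
  intro l hl
  apply hcl (l+1)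
  rw [← hbs', ← add_assoc]
  apply hb2 _ l hl
  have h1 : s₀.u.length + (l+1) ≤ b (s₀.u.length + (l+1)) := hmono.id_le _
  have h2 := hg0 (b (s₀.u.length + (l+1)))
  omega

theorem contradiction (S : Setup) : False := by
  obtain ⟨g, hg0, hg⟩ := S.exists_g
  obtain ⟨F, Ψ, hF, hb⟩ := S.exists_tree g
  have hb' : ∀ b : ℕ → ℕ, (∀ n, b n ∈ F (res b n)) → StrictMono b ∧
      (∀ n, ∀ l ∈ Ψ (res b n), l ∈ S.Y b) := fun b h => ⟨(hb b h).1, (hb b h).2.1⟩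
  obtain ⟨s1, t, e1, g1⟩ := S.claim1 F Ψ hF hb' false ⟨fun _ => (true, true), 0, []⟩ trivial
  obtain ⟨s2, t', e2, g2⟩ := S.claim1 F Ψ hF hb' true s1 e1.2.2.1
  obtain ⟨s3, e3, h3⟩ := S.claim2 F g hg0 hg Ψ hF hb true s2 e2.2.2.1
  have g3 := S.Good_ext F g2 e3
  have e13 := S.Ext_trans F e2 e3
  obtain ⟨t0, ht, ht'⟩ : ∃ t0 : Bool × Bool, t0 ≠ t ∧ t0 ≠ t' := by
    have : ∀ t t' : Bool × Bool, ∃ t0 : Bool × Bool, t0 ≠ t ∧ t0 ≠ t' := by decide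
    exact this t t'
  let a : ℕ → Bool × Bool := fun j => if j < s3.n then s3.a j else t0
  have ha : ∀ j < s3.n, a j = s3.a j := fun j hj => by simp [a, hj]
  have ha' : ∀ j, s3.n ≤ j → a j = t0 := fun j hj => by simp [a, not_lt.2 hj]
  have hS : ∀ᶠ k in (UU : Filter ℕ), ∃ N, S.Fo a N k false := by
    filter_upwards [h3, hF s3.u] with k ⟨l, hl, hnl⟩ hk
    refine ⟨l+1, fun c hc hca => ?_⟩
    by_contra hne
    have hne : S.Θ c k = true := by simpa using hne
    obtain ⟨m, hm, hm'⟩ := S.Fo_of_mem hc k (l+1)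
    rw [hne] at hm'
    have := g3 ⟨c, m, k :: s3.u⟩ ⟨by show s3.n ≤ m; omega, fun j hj => by
      show c j = _
      rw [hca j (by omega), ha j hj], ⟨hk, e3.2.2.1⟩, [k], rfl, fun k' hk' => by
        rw [List.mem_singleton.1 hk']; exact hm'⟩ l hl hnl (by show l < m; omega)
    simp only at this
    rw [hca l (by omega), ha' l hnl] at this
    exact ht' this
  obtain ⟨b, hbu, hbS⟩ := exists_branch s1.u (fun v => {k | k ∈ F v ∧ ∃ N, S.Fo a N k false})
    (fun v => (hF v).and hS)
  have hbr : ∀ n, b n ∈ F (res b n) := by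
    intro n
    by_cases hn : n < s1.u.length
    · exact TN_res (m := s1.u.length) (by rw [hbu]; exact e1.2.2.1) n hn
    · exact (hbS n (by omega)).1
  obtain ⟨hmono, hb1, hb2⟩ := hb b hbr
  have hfo : ∀ m, s1.u.length ≤ m → ∃ N, ∀ k v, res b m = v ++ s1.u → k ∈ v →
      S.Fo a N k false := by
    intro m hm
    induction m, hm using Nat.le_induction with
    | base =>
      refine ⟨0, fun k v hv hk => ?_⟩
      rw [hbu] at hv
      have : v = [] := by simpa using hv
      simp [this] at hk
    | succ m hm ih =>
      obtain ⟨N, hN⟩ := ih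
      obtain ⟨N', hN'⟩ := (hbS m hm).2
      obtain ⟨w, hw, -⟩ := res_append b hm
      rw [hbu] at hw
      refine ⟨max N N', fun k v hv hk => ?_⟩
      rw [res_succ, hw] at hv
      have : v = b m :: w := by
        apply List.append_cancel_right (bs := s1.u)
        rw [← hv]; rfl
      rw [this] at hk
      rcases List.mem_cons.1 hk with rfl | hk
      · exact S.Fo_mono hN' (le_max_right _ _) (fun _ _ => rfl)
      · exact S.Fo_mono (hN k w hw hk) (le_max_left _ _) (fun _ _ => rfl)
  apply S.hYinf b hmono
  apply (Set.finite_Iio s3.n).subset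
  intro l hl
  by_contra hl3
  have hl3 : s3.n ≤ l := by simpa using hl3
  set m := s1.u.length + (l + 1) with hmdef
  have hΨ : l ∈ Ψ (res b (m+1)) := by
    apply hb2 _ l hl
    have h1 : m ≤ b m := hmono.id_le _
    have h2 := hg0 (b m)
    omega
  obtain ⟨N, hN⟩ := hfo (m+1) (by omega)
  obtain ⟨w, hw, -⟩ := res_append b (m := s1.u.length) (n := m+1) (by omega)
  rw [hbu] at hw
  have h13 := e13.1
  have := g1 ⟨a, max N (l+1), res b (m+1)⟩ ⟨by
      show s1.n ≤ max N (l+1)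
      have := le_max_right N (l+1)
      omega, fun j hj => by
      show a j = _
      rw [ha j (by omega), e13.2.1 j hj], TN_of_res hbr _, w, hw, fun k hk =>
        S.Fo_mono (hN k w hw hk) (le_max_left _ _) (fun _ _ => rfl)⟩ l hΨ (by omega)
      (lt_of_lt_of_le (Nat.lt_succ_self l) (le_max_right _ _))
  simp only at this
  rw [ha' l hl3] at this
  exact ht this

end Setup

/-- Characteristic function of the range of a sequence. -/
noncomputable def chr (b : ℕ → ℕ) : ℕ → Bool := fun n => by
  classical exact decide (n ∈ Set.range b)

lemma bset_chr (b : ℕ → ℕ) : bset (chr b) = Set.range b := by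
  ext n; simp [bset, chr]

lemma measurable_chr : Measurable chr := by
  rw [measurable_pi_iff]
  intro n
  apply measurable_to_bool
  have : (fun b => chr b n) ⁻¹' {true} = ⋃ m, (fun b : ℕ → ℕ => b m) ⁻¹' {n} := by
    ext b; simp [chr]
  rw [this]
  exact MeasurableSet.iUnion (fun m => measurable_pi_apply m (measurableSet_singleton n))

lemma measurable_infset : MeasurableSet {x : ℕ → Bool | (bset x).Infinite} := by
  have : {x : ℕ → Bool | (bset x).Infinite} =
      ⋂ N : ℕ, ⋃ n : ℕ, {x : ℕ → Bool | N < n ∧ x n = true} := by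
    ext x
    simp only [Set.mem_iInter, Set.mem_iUnion]
    constructor
    · intro h N
      obtain ⟨n, h1, h2⟩ := Set.Infinite.exists_gt h N
      exact ⟨n, h2, h1⟩
    · intro h
      apply Set.infinite_of_forall_exists_gt
      intro N
      obtain ⟨n, h1, h2⟩ := h N
      exact ⟨n, h2, h1⟩
  rw [this]
  refine MeasurableSet.iInter fun N => MeasurableSet.iUnion fun n => ?_
  by_cases h : N < n
  · simp only [h, true_and]
    have hm : MeasurableSet ((fun x : ℕ → Bool => x n) ⁻¹' {true}) :=
      measurable_pi_apply n (measurableSet_singleton true)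
    exact hm
  · simp [h]

/-- Borel maps are continuous on a comeager set. -/
lemma exists_comeager (Θ : (ℕ → Bool × Bool) → ℕ → Bool) (hΘ : Measurable Θ) :
    ∃ Gn : ℕ → Set (ℕ → Bool × Bool),
      (∀ (j : ℕ) (a : ℕ → Bool × Bool) (n : ℕ), ∃ (a' : ℕ → Bool × Bool) (n' : ℕ), n ≤ n' ∧
        (∀ i < n, a' i = a i) ∧ ∀ c : ℕ → Bool × Bool, (∀ i < n', c i = a' i) → c ∈ Gn j) ∧
      (∀ c : ℕ → Bool × Bool, (∀ j, c ∈ Gn j) → ∀ k, ∃ m : ℕ, ∀ d : ℕ → Bool × Bool,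
        (∀ j, d ∈ Gn j) → (∀ i < m, d i = c i) → Θ d k = Θ c k) := by
  have hopen : ∀ (U : Set (ℕ → Bool × Bool)), IsOpen U → ∀ x ∈ U, ∀ n, ∃ m, n ≤ m ∧
      ∀ c : ℕ → Bool × Bool, (∀ i < m, c i = x i) → c ∈ U := by
    intro U hU x hx n
    obtain ⟨_, ⟨y, m, rfl⟩, h1, h2⟩ :=
      (isTopologicalBasis_cylinders (fun _ : ℕ => Bool × Bool)).exists_subset_of_mem_open hx hU
    refine ⟨max n m, le_max_left _ _, fun c hc => h2 ?_⟩
    rw [mem_cylinder_iff] at h1 ⊢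
    intro i hi
    rw [hc i (lt_of_lt_of_le hi (le_max_right _ _)), h1 i hi]
  have hres : ∀ (k : ℕ) (i : Bool), ∃ U : Set (ℕ → Bool × Bool), IsOpen U ∧
      ∀ᶠ c in residual (ℕ → Bool × Bool), (Θ c k = i ↔ c ∈ U) := by
    intro k i
    have hm : MeasurableSet {c | Θ c k = i} :=
      ((measurable_pi_apply k).comp hΘ) (measurableSet_singleton i)
    obtain ⟨U, hU, hU'⟩ := hm.residualEq_isOpen
    refine ⟨U, hU, ?_⟩
    filter_upwards [hU'] with c hc
    exact iff_of_eq hc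
  choose U hU hU' using hres
  have hall : ∀ᶠ c in residual (ℕ → Bool × Bool), ∀ k i, (Θ c k = i ↔ c ∈ U k i) := by
    rw [eventually_countable_forall]
    intro k
    rw [eventually_countable_forall]
    intro i
    exact hU' k i
  obtain ⟨T, hT, hGd, hD⟩ := mem_residual.1 hall
  obtain ⟨Gn, hGn, rfl⟩ := hGd.eq_iInter_nat
  refine ⟨Gn, ?_, ?_⟩
  · intro j a n
    obtain ⟨x, hx1, hx2⟩ := hD.exists_mem_open (isOpen_cylinder (fun _ : ℕ => Bool × Bool) a n)
      ⟨a, self_mem_cylinder a n⟩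
    obtain ⟨m, hm, hm'⟩ := hopen (Gn j) (hGn j) x (Set.mem_iInter.1 hx1 j) n
    exact ⟨x, m, hm, fun i hi => mem_cylinder_iff.1 hx2 i hi, hm'⟩
  · intro c hc k
    have h1 := hT (Set.mem_iInter.2 hc) k (Θ c k)
    obtain ⟨m, -, hm⟩ := hopen (U k (Θ c k)) (hU _ _) c (h1.1 rfl) 0
    refine ⟨m, fun d hd hdm => ?_⟩
    exact (hT (Set.mem_iInter.2 hd) k (Θ c k)).2 (hm d hdm)

/-- Combining two colourings into a sequence. -/
def comb (c : ℕ → Bool × Bool) : ℕ → (ℕ → Bool) := fun n j =>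
  if n = 0 then (c j).1 else (c j).2

lemma measurable_comb : Measurable comb := by
  rw [measurable_pi_iff]
  intro n
  rw [measurable_pi_iff]
  intro j
  by_cases h : n = 0
  · simp only [comb, h, if_true]
    exact measurable_fst.comp (measurable_pi_apply j)
  · simp only [comb, h, if_false]
    exact measurable_snd.comp (measurable_pi_apply j)

/-- There are no Borel maps `φ : (2^ℕ)^ℕ → 2^ℕ` and `ψ : [ω]^ω → [ω]^ω` such
that whenever `φ(⟨c_n⟩)` is almost constant on `B`, every `c_n` is almost
constant on `ψ(B)`.  (No Borel Tukey morphism from 𝔯 to 𝔯_σ.) -/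
theorem stmt11 :
    ¬ ∃ (φ : (ℕ → (ℕ → Bool)) → (ℕ → Bool)) (ψ : InfC → InfC),
      Measurable φ ∧ Measurable ψ ∧
      ∀ (c : ℕ → (ℕ → Bool)) (B : InfC),
        AlmostConst (φ c) (bset B.1) →
        ∀ n : ℕ, AlmostConst (c n) (bset (ψ B).1) := by
  rintro ⟨φ, ψ, hφ, hψ, H⟩
  obtain ⟨Gn, hG, hcont⟩ := exists_comeager (fun c => φ (comb c)) (hφ.comp measurable_comb)
  have hinf : ∀ b : ℕ → ℕ, StrictMono b → (bset (chr b)).Infinite := by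
    intro b hb
    rw [bset_chr]
    exact Set.infinite_range_of_injective hb.injective
  refine Setup.contradiction
    { Θ := fun c => φ (comb c)
      Gn := Gn
      Y := fun b => {l | ∃ h : (bset (chr b)).Infinite, (ψ ⟨chr b, h⟩).1 l = true}
      hG := hG
      hcont := hcont
      hYinf := ?_
      hYram := ?_
      hH := ?_ }
  · intro b hb
    refine (ψ ⟨chr b, hinf b hb⟩).2.mono ?_
    intro l hl
    exact ⟨hinf b hb, hl⟩
  · intro l u
    apply ramsey_borel {b | ∃ h : (bset (chr b)).Infinite, (ψ ⟨chr b, h⟩).1 l = true}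
    have h1 : MeasurableSet {B : InfC | (ψ B).1 l = true} :=
      ((measurable_pi_apply l).comp (measurable_subtype_coe.comp hψ)) (measurableSet_singleton true)
    have h2 := measurable_infset.subtype_image h1
    have h3 := measurable_chr h2
    convert h3 using 1
    ext b
    simp only [Set.mem_preimage, Set.mem_image]
    constructor
    · rintro ⟨h, h'⟩
      exact ⟨⟨chr b, h⟩, h', rfl⟩
    · rintro ⟨⟨x, hx⟩, h', rfl⟩
      exact ⟨hx, h'⟩
  · intro b hb c i N hN
    have hac : AlmostConst (φ (comb c)) (bset (chr b)) := by
      refine ⟨i, ((Set.finite_Iio N).image b).subset ?_⟩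
      rintro n ⟨h1, h2⟩
      rw [bset_chr] at h1
      obtain ⟨m, rfl⟩ := h1
      refine ⟨m, ?_, rfl⟩
      by_contra hm
      exact h2 (hN m (by simpa using hm))
    obtain ⟨t0, h0⟩ := H (comb c) ⟨chr b, hinf b hb⟩ hac 0
    obtain ⟨t1, h1⟩ := H (comb c) ⟨chr b, hinf b hb⟩ hac 1
    obtain ⟨N', hN'⟩ := (h0.union h1).bddAbove
    refine ⟨(t0, t1), N' + 1, ?_⟩
    rintro l ⟨h, hl⟩ hle
    have hnot : l ∉ _ := fun hmem => absurd (hN' hmem) (by omega)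
    rw [Set.mem_union, not_or] at hnot
    ext1
    · by_contra hne
      exact hnot.1 ⟨hl, by simpa [comb] using hne⟩
    · by_contra hne
      exact hnot.2 ⟨hl, by simpa [comb] using hne⟩
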